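/- arXiv:2211.09444 — 2 statements merged into one kernel-verified Lean document; each statement's English description precedes it below -/
import Mathlib

section
/- Let M = (M^m)_{m≥0} be a mould with M^0 = 0 and M^1 = 0 which is alternal and such that swap(M) + C is alternil for some constant mould C. Then M satisfies Ecalle's senary relation at depths r = 1, 2 and 3. -/
open MvPolynomial
open scoped TensorProduct

open MvPolynomial

/-- A mould: a family `M = (M^m)_{m ≥ 0}` with `M^m ∈ ℚ[x_1,…,x_m]`. -/
abbrev Mould : Type := (m : ℕ) → MvPolynomial (Fin m) ℚ

/-- Evaluation of the depth-`m` component of a mould at a vector `v`. -/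
noncomputable def mEval {K : Type} [CommRing K] (f : ℚ →+* K) (M : Mould) {m : ℕ}
    (v : Fin m → K) : K :=
  MvPolynomial.eval₂ f v (M m)

/-- The rational function field `ℚ(x_1,…,x_n)`. -/
abbrev FF (n : ℕ) : Type := FractionRing (MvPolynomial (Fin n) ℚ)

/-- The variable `x_i` as an element of `ℚ(x_1,…,x_n)`. -/
noncomputable def xv {n : ℕ} (i : Fin n) : FF n :=
  algebraMap (MvPolynomial (Fin n) ℚ) (FF n) (X i)

/-- Ecalle's senary relation at depth `r = s+1`, as an identity in `ℚ(y_1,…,y_r)`: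
`M^r(y_1,…,y_r) + (M^{r-1}(y_1,…,y_{r-2},y_{r-1}+y_r) - M^{r-1}(y_1,…,y_{r-1}))/y_r
 = M^r(-y_1-⋯-y_r, y_1,…,y_{r-1})
   + (M^{r-1}(-y_2-⋯-y_r, y_2,…,y_{r-1}) - M^{r-1}(y_1,…,y_{r-1}))/(y_1+⋯+y_r)`. -/
noncomputable def SenaryAt (M : Mould) (s : ℕ) : Prop :=
  mEval (Rat.castHom (FF (s+1))) M (fun i : Fin (s+1) => xv i)
    + (mEval (Rat.castHom (FF (s+1))) M (fun i : Fin s =>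
          if i.val = s - 1 then xv (⟨s-1, by omega⟩ : Fin (s+1)) + xv (Fin.last s)
          else xv i.castSucc)
       - mEval (Rat.castHom (FF (s+1))) M (fun i : Fin s => xv i.castSucc)) / xv (Fin.last s)
  = mEval (Rat.castHom (FF (s+1))) M (fun i : Fin (s+1) =>
        if i.val = 0 then -(∑ j : Fin (s+1), xv j)
        else xv (⟨i.val - 1, by have := i.isLt; omega⟩ : Fin (s+1)))
    + (mEval (Rat.castHom (FF (s+1))) M (fun i : Fin s =>
          if i.val = 0 then -(∑ j : Fin s, xv j.succ) else xv i.castSucc)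
       - mEval (Rat.castHom (FF (s+1))) M (fun i : Fin s => xv i.castSucc))
      / (∑ j : Fin (s+1), xv j)
/-- The swap of a mould: `swap(M)^m(v_1,…,v_m) = M^m(v_m, v_{m-1}-v_m, …, v_1-v_2)`. -/
noncomputable def swapM (M : Mould) : Mould := fun m =>
  MvPolynomial.eval₂ MvPolynomial.C
    (fun i : Fin m =>
      (MvPolynomial.X ⟨m - 1 - i.val, by have := i.isLt; omega⟩ : MvPolynomial (Fin m) ℚ)
        - (if h : i.val = 0 then 0
           else MvPolynomial.X ⟨m - i.val, by have := i.isLt; omega⟩))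
    (M m)

open scoped Classical in
/-- Alternality of a mould: `M^0 = 0` and for all `p, q ≥ 1` the sum of
`M^{p+q}(x_{σ(1)},…,x_{σ(p+q)})` over the `(p,q)`-shuffle permutations vanishes. -/
noncomputable def IsAlternal (M : Mould) : Prop :=
  M 0 = 0 ∧ ∀ p q : ℕ, 1 ≤ p → 1 ≤ q →
    ∑ σ : Equiv.Perm (Fin (p+q)),
      (if ((∀ i j : Fin (p+q), i < j → j.val < p → σ.symm i < σ.symm j) ∧
           (∀ i j : Fin (p+q), i < j → p ≤ i.val → σ.symm i < σ.symm j))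
       then MvPolynomial.eval₂ MvPolynomial.C
              (fun i => (X (σ i) : MvPolynomial (Fin (p+q)) ℚ)) (M (p+q))
       else 0) = 0

/-- The field `ℚ(y_1, y_2, …)` (the variable `X i` stands for `y_{i+1}`). -/
abbrev Kinf : Type := FractionRing (MvPolynomial ℕ ℚ)

noncomputable def yvar (i : ℕ) : Kinf := algebraMap (MvPolynomial ℕ ℚ) Kinf (X i)

/-- A letter: a `ℤ`-linear combination of the letters `x_1, x_2, …`
(the generator `i` stands for `x_{i+1}`). -/
abbrev Letter : Type := ℕ →₀ ℤ

/-- The value of a letter under `x_i ↦ y_i`. -/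
noncomputable def letterVal (l : Letter) : Kinf := l.sum fun i n => (n : Kinf) * yvar i

/-- `f(u) = 1/(n_1 y_{i_1} + ⋯ + n_k y_{i_k})` for `u = n_1 x_{i_1} + ⋯ + n_k x_{i_k} ≠ 0`,
and `f(0) = 0`. -/
noncomputable def collide (l : Letter) : Kinf := (letterVal l)⁻¹

/-- The `ш*` product of two words, as a formal `ℚ(y_1,y_2,…)`-linear combination of words:
`uω ш* vη = u(ω ш* vη) + v(uω ш* η) + f(u-v)·(u(ω ш* η) - v(ω ш* η))`. -/
noncomputable def shMul : List Letter → List Letter → (List Letter →₀ Kinf)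
  | [], η => Finsupp.single η 1
  | ω, [] => Finsupp.single ω 1
  | u :: ω, v :: η =>
      Finsupp.mapDomain (List.cons u) (shMul ω (v :: η))
        + Finsupp.mapDomain (List.cons v) (shMul (u :: ω) η)
        + collide (u - v) • (Finsupp.mapDomain (List.cons u) (shMul ω η)
            - Finsupp.mapDomain (List.cons v) (shMul ω η))
  termination_by ω η => ω.length + η.length

/-- `N^{l(α)}(α)`, evaluated with `y_i := x_i`. -/
noncomputable def wordEval (N : Mould) (α : List Letter) : Kinf :=
  MvPolynomial.eval₂ (Rat.castHom Kinf) (fun j : Fin α.length => letterVal (α.get j))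
    (N α.length)

/-- Alternility of a mould: `N^0 = 0` and for all `p, q ≥ 1`,
`Σ_α ⟨(x_1,…,x_p) ш* (x_{p+1},…,x_{p+q}) | α⟩|_{y_i := x_i} · N^{l(α)}(α) = 0`. -/
noncomputable def IsAlternil (N : Mould) : Prop :=
  N 0 = 0 ∧ ∀ p q : ℕ, 1 ≤ p → 1 ≤ q →
    (shMul ((List.range p).map fun j => Finsupp.single j 1)
           ((List.range q).map fun j => Finsupp.single (p + j) 1)).sum
      (fun α c => c * wordEval N α) = 0

/-- Evaluation of a mould commutes with ring homomorphisms. -/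
lemma map_mEval {K L : Type} [CommRing K] [CommRing L] (φ : K →+* L) (f : ℚ →+* K) (g : ℚ →+* L)
    (M : Mould) {m : ℕ} (v : Fin m → K) : φ (mEval f M v) = mEval g M (fun i => φ (v i)) := by
  unfold mEval
  rw [MvPolynomial.hom_eval₂, Subsingleton.elim (φ.comp f) g]

lemma map_mEval_two {K L : Type} [CommRing K] [CommRing L] (φ : K →+* L) (f : ℚ →+* K)
    (g : ℚ →+* L) (M : Mould) (a b : K) :
    φ (mEval f M ![a, b]) = mEval g M ![φ a, φ b] := by
  rw [map_mEval φ f g]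
  congr 1
  ext i
  fin_cases i <;> rfl

lemma map_mEval_three {K L : Type} [CommRing K] [CommRing L] (φ : K →+* L) (f : ℚ →+* K)
    (g : ℚ →+* L) (M : Mould) (a b c : K) :
    φ (mEval f M ![a, b, c]) = mEval g M ![φ a, φ b, φ c] := by
  rw [map_mEval φ f g]
  congr 1
  ext i
  fin_cases i <;> rfl

section Alternality

variable {M : Mould}

/-- Alternality in depth two, evaluated in an arbitrary commutative ring over `ℚ`. -/
lemma IsAlternal.depth_two (hal : IsAlternal M) {K : Type} [CommRing K] (f : ℚ →+* K) (a b : K) :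
    mEval f M ![a, b] + mEval f M ![b, a] = 0 := by
  classical
  have h := hal.2 1 1 le_rfl le_rfl
  rw [← Finset.sum_filter] at h
  have hs : (Finset.univ.filter fun σ : Equiv.Perm (Fin (1 + 1)) =>
      (∀ i j : Fin (1 + 1), i < j → j.val < 1 → σ.symm i < σ.symm j) ∧
        (∀ i j : Fin (1 + 1), i < j → 1 ≤ i.val → σ.symm i < σ.symm j))
      = {1, Equiv.swap 0 1} := by
    decide
  have hsum : ∑ σ ∈ ({1, Equiv.swap 0 1} : Finset (Equiv.Perm (Fin (1 + 1)))),
      MvPolynomial.eval₂ MvPolynomial.C (fun i => (X (σ i) : MvPolynomial (Fin (1 + 1)) ℚ))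
        (M (1 + 1)) = 0 := by
    rw [← hs, ← h]
  have h' := congrArg (MvPolynomial.eval₂Hom f ![a, b]) hsum
  rw [Finset.sum_pair (by decide), map_add, map_zero] at h'
  simp only [MvPolynomial.hom_eval₂] at h'
  rw [← h']
  unfold mEval
  congr 1
  all_goals
    rw [Subsingleton.elim (RingHom.comp _ _) f]
    congr 1
    ext i
    fin_cases i <;> simp

/-- Alternality in depth three, evaluated in an arbitrary commutative ring over `ℚ`. -/
lemma IsAlternal.depth_three (hal : IsAlternal M) {K : Type} [CommRing K] (f : ℚ →+* K)
    (a b c : K) :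
    mEval f M ![a, b, c] + mEval f M ![b, a, c] + mEval f M ![b, c, a] = 0 := by
  classical
  have h := hal.2 1 2 le_rfl one_le_two
  rw [← Finset.sum_filter] at h
  have hs : (Finset.univ.filter fun σ : Equiv.Perm (Fin (1 + 2)) =>
      (∀ i j : Fin (1 + 2), i < j → j.val < 1 → σ.symm i < σ.symm j) ∧
        (∀ i j : Fin (1 + 2), i < j → 1 ≤ i.val → σ.symm i < σ.symm j))
      = {1, Equiv.swap 0 1, finRotate 3} := by
    decide
  have hsum : ∑ σ ∈ ({1, Equiv.swap 0 1, finRotate 3} : Finset (Equiv.Perm (Fin (1 + 2)))),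
      MvPolynomial.eval₂ MvPolynomial.C (fun i => (X (σ i) : MvPolynomial (Fin (1 + 2)) ℚ))
        (M (1 + 2)) = 0 := by
    rw [← hs, ← h]
  have h' := congrArg (MvPolynomial.eval₂Hom f ![a, b, c]) hsum
  rw [Finset.sum_insert (by decide), Finset.sum_pair (by decide), map_add, map_add, map_zero,
    ← add_assoc] at h'
  simp only [MvPolynomial.hom_eval₂] at h'
  rw [← h']
  unfold mEval
  congr 1
  congr 1
  all_goals
    rw [Subsingleton.elim (RingHom.comp _ _) f]
    congr 1
    ext i
    fin_cases i <;> simp [Equiv.swap_apply_def]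

end Alternality

section Stuffle

/-- The pairing of `ω ш* η` with a function on words. -/
noncomputable def shPair (w : List Letter → Kinf) (ω η : List Letter) : Kinf :=
  Finsupp.linearCombination Kinf w (shMul ω η)

lemma shPair_nil_left (w : List Letter → Kinf) (η : List Letter) : shPair w [] η = w η := by
  simp [shPair, shMul]

lemma shPair_nil_right (w : List Letter → Kinf) (ω : List Letter) : shPair w ω [] = w ω := by
  cases ω <;> simp [shPair, shMul]

lemma shPair_cons_cons (w : List Letter → Kinf) (u v : Letter) (ω η : List Letter) :
    shPair w (u :: ω) (v :: η) =
      shPair (fun α => w (u :: α)) ω (v :: η) + shPair (fun α => w (v :: α)) (u :: ω) η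
        + collide (u - v) *
          (shPair (fun α => w (u :: α)) ω η - shPair (fun α => w (v :: α)) ω η) := by
  simp only [shPair]
  rw [shMul]
  simp only [map_add, map_smul, map_sub, Finsupp.linearCombination_mapDomain, smul_eq_mul]
  rfl

lemma IsAlternil.shPair_eq_zero {N : Mould} (hN : IsAlternil N) {p q : ℕ} (hp : 1 ≤ p)
    (hq : 1 ≤ q) :
    shPair (wordEval N) ((List.range p).map fun j => Finsupp.single j 1)
      ((List.range q).map fun j => Finsupp.single (p + j) 1) = 0 :=
  hN.2 p q hp hq

lemma letterVal_single (i : ℕ) : letterVal (Finsupp.single i 1) = yvar i := by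
  simp [letterVal]

lemma collide_single_sub_single (i j : ℕ) :
    collide (Finsupp.single i 1 - Finsupp.single j 1) = (yvar i - yvar j)⁻¹ := by
  have h : letterVal (Finsupp.single i 1 - Finsupp.single j 1)
      = letterVal (Finsupp.single i 1) - letterVal (Finsupp.single j 1) := by
    unfold letterVal
    exact Finsupp.sum_sub_index fun _ _ _ => by push_cast; ring
  rw [collide, h, letterVal_single, letterVal_single]

lemma yvar_sub_ne_zero {i j : ℕ} (h : i ≠ j) : yvar i - yvar j ≠ 0 := by
  rw [sub_ne_zero]
  intro e
  exact h (MvPolynomial.X_injective (IsFractionRing.injective (MvPolynomial ℕ ℚ) Kinf e))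

end Stuffle

section Swap

variable (M : Mould) (c : ℕ → ℚ)

lemma wordEval_swap_one (u : Letter) :
    wordEval (fun m => swapM M m + MvPolynomial.C (c m)) [u]
      = mEval (Rat.castHom Kinf) M ![letterVal u] + (c 1 : Kinf) := by
  simp only [wordEval, swapM, mEval, MvPolynomial.eval₂_add, MvPolynomial.eval₂_C]
  congr 1
  rw [← MvPolynomial.coe_eval₂Hom, MvPolynomial.hom_eval₂]
  rw [Subsingleton.elim (RingHom.comp _ _) (Rat.castHom Kinf)]
  change MvPolynomial.eval₂ _ _ (M 1) = _
  congr 1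
  ext i
  fin_cases i
  simp

lemma wordEval_swap_two (u v : Letter) :
    wordEval (fun m => swapM M m + MvPolynomial.C (c m)) [u, v]
      = mEval (Rat.castHom Kinf) M ![letterVal v, letterVal u - letterVal v] + (c 2 : Kinf) := by
  simp only [wordEval, swapM, mEval, MvPolynomial.eval₂_add, MvPolynomial.eval₂_C]
  congr 1
  rw [← MvPolynomial.coe_eval₂Hom, MvPolynomial.hom_eval₂]
  rw [Subsingleton.elim (RingHom.comp _ _) (Rat.castHom Kinf)]
  change MvPolynomial.eval₂ _ _ (M 2) = _
  congr 1
  ext i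
  fin_cases i <;> simp

lemma wordEval_swap_three (u v w : Letter) :
    wordEval (fun m => swapM M m + MvPolynomial.C (c m)) [u, v, w]
      = mEval (Rat.castHom Kinf) M
          ![letterVal w, letterVal v - letterVal w, letterVal u - letterVal v] + (c 3 : Kinf) := by
  simp only [wordEval, swapM, mEval, MvPolynomial.eval₂_add, MvPolynomial.eval₂_C]
  congr 1
  rw [← MvPolynomial.coe_eval₂Hom, MvPolynomial.hom_eval₂]
  rw [Subsingleton.elim (RingHom.comp _ _) (Rat.castHom Kinf)]
  change MvPolynomial.eval₂ _ _ (M 3) = _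
  congr 1
  ext i
  fin_cases i <;> simp

end Swap

/-- Specialization of polynomial identities in `ℚ(y_1, y_2, …)`. -/
lemma eval₂_eq_zero_of_algebraMap_eq_zero {K : Type} [CommRing K] (f : ℚ →+* K) (v : ℕ → K)
    {p : MvPolynomial ℕ ℚ} (hp : algebraMap (MvPolynomial ℕ ℚ) Kinf p = 0) :
    MvPolynomial.eval₂Hom f v p = 0 := by
  rw [(map_eq_zero_iff _ (IsFractionRing.injective (MvPolynomial ℕ ℚ) Kinf)).mp hp, map_zero]

lemma algebraMap_C_eq_ratCast (r : ℚ) :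
    algebraMap (MvPolynomial ℕ ℚ) Kinf (MvPolynomial.C r) = (r : Kinf) :=
  map_ratCast ((algebraMap (MvPolynomial ℕ ℚ) Kinf).comp MvPolynomial.C) r

section Relations

variable {M : Mould} {c : ℕ → ℚ} {K : Type}

/-- Alternility of `swap(M) + C` in depth two when `M` vanishes in depth one, specialized to
an arbitrary commutative ring over `ℚ`. -/
lemma alternil_depth_two [CommRing K] (h1 : M 1 = 0)
    (hil : IsAlternil (fun m => swapM M m + MvPolynomial.C (c m))) (f : ℚ →+* K) (a b : K) :
    mEval f M ![b, a - b] + mEval f M ![a, b - a] + 2 * f (c 2) = 0 := by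
  have h := hil.shPair_eq_zero (p := 1) (q := 1) le_rfl le_rfl
  simp only [List.range_succ, List.range_zero, List.nil_append, List.map_cons, List.map_nil,
    shPair_cons_cons, shPair_nil_left, shPair_nil_right, wordEval_swap_one, wordEval_swap_two,
    letterVal_single, add_zero] at h
  have hz : ∀ v : Fin 1 → Kinf, mEval (Rat.castHom Kinf) M v = 0 := fun v => by simp [mEval, h1]
  simp only [hz, sub_self, mul_zero, add_zero] at h
  have hp := eval₂_eq_zero_of_algebraMap_eq_zero f (fun n => if n = 0 then a else b)
    (p := mEval MvPolynomial.C M ![X 1, X 0 - X 1] + mEval MvPolynomial.C M ![X 0, X 1 - X 0]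
      + 2 * MvPolynomial.C (c 2)) (by
      simp only [map_add, map_sub, map_mul, map_ofNat, algebraMap_C_eq_ratCast,
        map_mEval_two _ MvPolynomial.C (Rat.castHom Kinf)]
      simp only [yvar] at h
      linear_combination h)
  simpa only [map_add, map_sub, map_mul, map_ofNat, map_mEval_two _ MvPolynomial.C f,
    MvPolynomial.coe_eval₂Hom, MvPolynomial.eval₂_C, MvPolynomial.eval₂_X, if_true,
    one_ne_zero, if_false] using hp

/-- Alternility of `swap(M) + C` in depth three, specialized to pairwise distinct elements of a
field. -/
lemma alternil_depth_three [Field K]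
    (hil : IsAlternil (fun m => swapM M m + MvPolynomial.C (c m))) (f : ℚ →+* K) {x y z : K}
    (hxy : x - y ≠ 0) (hxz : x - z ≠ 0) :
    mEval f M ![z, y - z, x - y] + mEval f M ![z, x - z, y - x] + mEval f M ![x, z - x, y - z]
      + 3 * f (c 3)
      + (mEval f M ![x, y - x] - mEval f M ![z, y - z]) / (x - z)
      + (mEval f M ![z, x - z] - mEval f M ![z, y - z]) / (x - y) = 0 := by
  have h := hil.shPair_eq_zero (p := 1) (q := 2) le_rfl one_le_two
  simp only [List.range_succ, List.range_zero, List.nil_append, List.cons_append, List.map_cons,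
    List.map_nil, shPair_cons_cons, shPair_nil_left, shPair_nil_right, wordEval_swap_two,
    wordEval_swap_three, letterVal_single, collide_single_sub_single, add_zero,
    Nat.reduceAdd] at h
  have h01 := yvar_sub_ne_zero (i := 0) (j := 1) (by decide)
  have h02 := yvar_sub_ne_zero (i := 0) (j := 2) (by decide)
  field_simp at h
  have hp := eval₂_eq_zero_of_algebraMap_eq_zero f
    (fun n => if n = 0 then x else if n = 1 then y else z)
    (p := (mEval MvPolynomial.C M ![X 2, X 1 - X 2, X 0 - X 1]
      + mEval MvPolynomial.C M ![X 2, X 0 - X 2, X 1 - X 0]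
      + mEval MvPolynomial.C M ![X 0, X 2 - X 0, X 1 - X 2]
      + 3 * MvPolynomial.C (c 3)) * (X 0 - X 1) * (X 0 - X 2)
      + (mEval MvPolynomial.C M ![X 0, X 1 - X 0] - mEval MvPolynomial.C M ![X 2, X 1 - X 2])
        * (X 0 - X 1)
      + (mEval MvPolynomial.C M ![X 2, X 0 - X 2] - mEval MvPolynomial.C M ![X 2, X 1 - X 2])
        * (X 0 - X 2)) (by
      simp only [map_add, map_sub, map_mul, map_ofNat, algebraMap_C_eq_ratCast,
        map_mEval_two _ MvPolynomial.C (Rat.castHom Kinf),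
        map_mEval_three _ MvPolynomial.C (Rat.castHom Kinf)]
      simp only [yvar] at h
      linear_combination h)
  simp only [map_add, map_sub, map_mul, map_ofNat, map_mEval_two _ MvPolynomial.C f,
    map_mEval_three _ MvPolynomial.C f, MvPolynomial.coe_eval₂Hom, MvPolynomial.eval₂_C,
    MvPolynomial.eval₂_X, if_true, one_ne_zero, OfNat.ofNat_ne_zero, OfNat.ofNat_ne_one,
    if_false] at hp
  field_simp
  linear_combination hp

/-- Under the hypotheses of `alternil_depth_two`, alternality forces the depth two constant to
vanish. -/
lemma swap_antisymm_depth_two [Field K] [CharZero K] (h1 : M 1 = 0) (hal : IsAlternal M)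
    (hil : IsAlternil (fun m => swapM M m + MvPolynomial.C (c m))) (f : ℚ →+* K) (a b : K) :
    mEval f M ![b, a - b] + mEval f M ![a, b - a] = 0 := by
  have hc := alternil_depth_two h1 hil f (0 : K) 0
  have h00 := hal.depth_two f (0 : K) 0
  rw [sub_zero] at hc
  linear_combination alternil_depth_two h1 hil f a b - hc + h00

/-- Invariance of the depth two component under the order six substitution
`(a, b) ↦ (-b, a + b)`. -/
lemma depth_two_rotate [Field K] [CharZero K] (h1 : M 1 = 0) (hal : IsAlternal M)
    (hil : IsAlternil (fun m => swapM M m + MvPolynomial.C (c m))) (f : ℚ →+* K) {a b nb s : K}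
    (hb : nb = -b) (hs : s = a + b) : mEval f M ![a, b] = mEval f M ![nb, s] := by
  have h := swap_antisymm_depth_two h1 hal hil f s a
  rw [show s - a = b by rw [hs]; ring, show a - s = nb by rw [hs, hb]; ring] at h
  linear_combination h - hal.depth_two f s nb

/-- The reversal relation for `swap(M)` in depth three, written in terms of `M`. -/
lemma swap_reverse_depth_three [Field K] [CharZero K] (h1 : M 1 = 0) (hal : IsAlternal M)
    (hil : IsAlternil (fun m => swapM M m + MvPolynomial.C (c m))) (f : ℚ →+* K)
    {p q r q' r' s t u : K} (hq : q ≠ 0) (hr : r ≠ 0) (ht : t ≠ 0) (hq' : q' = -q) (hr' : r' = -r)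
    (hs : s = p + q + r) (hqr : t = q + r) (hpq : u = p + q) :
    mEval f M ![p, q, r] - mEval f M ![s, r', q'] + (mEval f M ![p, t] - mEval f M ![p, q]) / r
      - (mEval f M ![p, t] - mEval f M ![u, r]) / q = 0 := by
  have e1 : s - u = r := by rw [hs, hpq]; ring
  have e2 : s - p = t := by rw [hs, hqr]; ring
  have e3 : u - p = q := by rw [hpq]; ring
  have e4 : p - u = q' := by rw [← neg_sub, e3, hq']
  have e5 : u - s = r' := by rw [← neg_sub, e1, hr']
  have hA := alternil_depth_three (x := s) (y := u) (z := p) hil f (by rwa [e1]) (by rwa [e2])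
  have hB := alternil_depth_three (x := p) (y := u) (z := s) hil f
    (by rw [e4, hq']; exact neg_ne_zero.mpr hq)
    (by rw [← neg_sub, e2]; exact neg_ne_zero.mpr ht)
  have hG1 := swap_antisymm_depth_two h1 hal hil f s p
  have hG2 := swap_antisymm_depth_two h1 hal hil f s u
  rw [e1, e2, e3, e5] at hA
  rw [e2, e3, e4, e5] at hB
  rw [e2] at hG1
  rw [e1, e5] at hG2
  have e6 : p - s = -t := by rw [← e2, neg_sub]
  rw [e6] at hA hB hG1
  simp only [hq', div_neg] at hA hB ⊢
  linear_combination hA - hB - hG1 / q + hG2 / q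

/-- The senary relation in depth two. -/
lemma senary_depth_two [Field K] [CharZero K] (h1 : M 1 = 0) (hal : IsAlternal M)
    (hil : IsAlternil (fun m => swapM M m + MvPolynomial.C (c m))) (f : ℚ →+* K) (a b : K) :
    mEval f M ![a, b] = mEval f M ![-(a + b), a] :=
  (depth_two_rotate h1 hal hil f rfl rfl).trans
    (depth_two_rotate h1 hal hil f rfl (by ring))

/-- The senary relation in depth three. -/
lemma senary_depth_three [Field K] [CharZero K] (h1 : M 1 = 0) (hal : IsAlternal M)
    (hil : IsAlternil (fun m => swapM M m + MvPolynomial.C (c m))) (f : ℚ →+* K) {a b d : K}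
    (hb : b ≠ 0) (hd : d ≠ 0) (had : a + d ≠ 0) (hbd : b + d ≠ 0)
    (habd : a + b + d ≠ 0) :
    mEval f M ![a, b, d] + (mEval f M ![a, b + d] - mEval f M ![a, b]) / d
      = mEval f M ![-(a + b + d), a, b]
        + (mEval f M ![-(b + d), b] - mEval f M ![a, b]) / (a + b + d) := by
  have hA := swap_reverse_depth_three h1 hal hil f (p := a) (q := -(a + b + d)) (r := b)
    (q' := a + b + d) (r' := -b) (s := -d) (t := -(a + d)) (u := -(b + d))
    (neg_ne_zero.mpr habd) hb (neg_ne_zero.mpr had)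
    (by ring) (by ring) (by ring) (by ring) (by ring)
  have hB := swap_reverse_depth_three h1 hal hil f (p := a + b + d) (q := -d) (r := -b)
    (q' := d) (r' := b) (s := a) (t := -(b + d)) (u := a + b)
    (neg_ne_zero.mpr hd) (neg_ne_zero.mpr hb) (neg_ne_zero.mpr hbd)
    (by ring) (by ring) (by ring) (by ring) (by ring)
  have hC := swap_reverse_depth_three h1 hal hil f (p := a) (q := b) (r := -(a + b + d))
    (q' := -b) (r' := a + b + d) (s := -d) (t := -(a + d)) (u := a + b)
    hb (neg_ne_zero.mpr habd) (neg_ne_zero.mpr had)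
    (by ring) (by ring) (by ring) (by ring) (by ring)
  have g1 : mEval f M ![a, -(a + b + d)] = mEval f M ![a + b + d, -(b + d)] :=
    depth_two_rotate h1 hal hil f (by ring) (by ring)
  have g2 : mEval f M ![a + b, -(a + b + d)] = mEval f M ![a + b + d, -d] :=
    depth_two_rotate h1 hal hil f (by ring) (by ring)
  have g3 : mEval f M ![a, b + d] = mEval f M ![-(b + d), a + b + d] :=
    depth_two_rotate h1 hal hil f (by ring) (by ring)
  have g4 := hal.depth_two f (-(b + d)) (a + b + d)
  have g5 : mEval f M ![a, b] = mEval f M ![-b, a + b] :=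
    depth_two_rotate h1 hal hil f (by ring) (by ring)
  have g6 := hal.depth_two f (-b) (a + b)
  have k1 := hal.depth_three f (a + b + d) (-d) (-b)
  have k2 := hal.depth_three f (-(a + b + d)) a b
  rw [g1] at hA
  rw [g2] at hC
  simp only [div_neg] at hA hB hC
  linear_combination hA - hB + hC + k1 - k2 + (g3 + g4 - g5 - g6) / d

end Relations

/-- The image in the fraction field of a polynomial with a nonzero value is nonzero. -/
lemma algebraMap_ne_zero_of_eval_ne_zero {n : ℕ} {p : MvPolynomial (Fin n) ℚ} (v : Fin n → ℚ)
    (hv : MvPolynomial.eval v p ≠ 0) : algebraMap (MvPolynomial (Fin n) ℚ) (FF n) p ≠ 0 := by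
  rw [Ne, map_eq_zero_iff _ (IsFractionRing.injective (MvPolynomial (Fin n) ℚ) (FF n))]
  rintro rfl
  exact hv (map_zero _)


/-- An alternal mould `M` with `M^0 = 0`, `M^1 = 0` such that
`swap(M) + C` is alternil for some constant mould `C` satisfies Ecalle's senary
relation at depths `r = 1, 2, 3`. -/
theorem senary_small_depths (M : Mould) (h0 : M 0 = 0) (h1 : M 1 = 0)
    (hal : IsAlternal M)
    (hil : ∃ c : ℕ → ℚ, IsAlternil (fun m => swapM M m + MvPolynomial.C (c m))) :
    SenaryAt M 0 ∧ SenaryAt M 1 ∧ SenaryAt M 2 := by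
  obtain ⟨c, hil⟩ := hil
  refine ⟨?_, ?_, ?_⟩
  · have hz : M (0 + 1) = 0 := h1
    simp [SenaryAt, mEval, h0, hz]
  · have hz : ∀ v : Fin 1 → FF (1 + 1), mEval (Rat.castHom (FF (1 + 1))) M v = 0 :=
      fun v => by simp [mEval, h1]
    have h := senary_depth_two h1 hal hil (Rat.castHom (FF (1 + 1))) (xv 0) (xv 1)
    simp only [SenaryAt, hz, sub_self, zero_div, add_zero]
    convert h using 1
    all_goals
      congr 1
      funext i
      fin_cases i <;> simp [Fin.sum_univ_two]
  · have h := senary_depth_three h1 hal hil (Rat.castHom (FF (2 + 1)))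
      (a := xv 0) (b := xv 1) (d := xv 2)
      (algebraMap_ne_zero_of_eval_ne_zero 1 (by simp))
      (algebraMap_ne_zero_of_eval_ne_zero 1 (by simp))
      (by
        rw [xv, xv, ← map_add]
        exact algebraMap_ne_zero_of_eval_ne_zero 1 (by simp))
      (by
        rw [xv, xv, ← map_add]
        exact algebraMap_ne_zero_of_eval_ne_zero 1 (by simp))
      (by
        rw [xv, xv, xv, ← map_add, ← map_add]
        exact algebraMap_ne_zero_of_eval_ne_zero 1 (by norm_num))
    unfold SenaryAt
    convert h using 4
    all_goals
      first
      | rfl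
      | exact Fin.sum_univ_three _
      | (rename_i i; fin_cases i <;> simp [Fin.sum_univ_three])
      | (congr 1; funext i; fin_cases i <;> simp [Fin.sum_univ_two])
end

section
/- Let M = (M^m)_{m≥0} be a mould with M^0 = 0 and M^1 = 0 such that ũ(M)^3(x_1,x_2,x_3) = ũ(M)^3(−x_2,−x_3,−x_1) holds identically. Then the following two identities hold in ℚ(x_1,x_2,x_3,x_4): coll^4_{3,4}(ũ(M))(x_1,x_3,x_2,x_4) = −coll^4_{2,3}(ũ(M))(−x_3,−x_2,−x_4,−x_1), and coll^4_{1,2}(ũ(M))(x_1,x_2,x_3,x_4) = −coll^4_{3,4}(ũ(M))(−x_3,−x_4,−x_1,−x_2). -/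
open MvPolynomial
open scoped TensorProduct

open MvPolynomial

/-- Evaluation of `ũ(M)^{m+1}` (where `ũ = t̃ ∘ swap`):
`ũ(M)^{m+1}(v_1,…,v_{m+1}) = M^m(v_{m+1}-v_1, v_m-v_{m+1}, v_{m-1}-v_m, …, v_2-v_3)`. -/
noncomputable def uEval {K : Type} [CommRing K] (f : ℚ →+* K) (M : Mould) {m : ℕ}
    (v : Fin (m+1) → K) : K :=
  mEval f M (fun j : Fin m =>
    if h : j.val = 0 then v (Fin.last m) - v 0
    else v ⟨m - j.val, by omega⟩ - v ⟨m - j.val + 1, by have := j.isLt; omega⟩)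

/-- `coll^{t+2}_{i,i+1}` (with `1`-indexed `i = k+1`) applied to `N = ũ(M)`,
evaluated at `v = (x_1,…,x_{t+2})`:
`(N^{t+1}(x_1,…,x_i,x_{i+2},…) - N^{t+1}(x_1,…,x_{i-1},x_{i+1},x_{i+2},…))/(x_i - x_{i+1})`. -/
noncomputable def collUEval {K : Type} [Field K] (f : ℚ →+* K) (M : Mould) {t : ℕ}
    (k : Fin (t+1)) (v : Fin (t+2) → K) : K :=
  (uEval f M (fun j : Fin (t+1) => v (Fin.succAbove k.succ j))
    - uEval f M (fun j : Fin (t+1) => v (Fin.succAbove k.castSucc j)))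
    / (v k.castSucc - v k.succ)

lemma map_uEval {K L : Type} [CommRing K] [CommRing L] (g : K →+* L) (f : ℚ →+* K)
    (M : Mould) {m : ℕ} (v : Fin (m + 1) → K) :
    g (uEval f M v) = uEval (g.comp f) M (g ∘ v) := by
  unfold uEval mEval
  rw [MvPolynomial.hom_eval₂]
  congr 1
  funext j
  simp only [Function.comp_apply]
  split_ifs <;> simp

/-- An identity between `ũ(M)³` at generic points specializes to every commutative `ℚ`-algebra. -/
lemma uEval_three_eq_of_generic {K : Type} [CommRing K] (f : ℚ →+* K) (M : Mould)
    (hcyc : uEval (Rat.castHom (FF 3)) M ![xv 0, xv 1, xv 2]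
        = uEval (Rat.castHom (FF 3)) M ![-xv 1, -xv 2, -xv 0]) (a b c : K) :
    uEval f M ![a, b, c] = uEval f M ![-b, -c, -a] := by
  have hpoly : uEval C M ![(X 0 : MvPolynomial (Fin 3) ℚ), X 1, X 2]
      = uEval C M ![-X 1, -X 2, -X 0] := by
    apply IsFractionRing.injective (MvPolynomial (Fin 3) ℚ) (FF 3)
    rw [map_uEval, map_uEval,
      Subsingleton.elim ((algebraMap (MvPolynomial (Fin 3) ℚ) (FF 3)).comp C)
        (Rat.castHom (FF 3))]
    convert hcyc using 2 <;> funext i <;> fin_cases i <;> simp [xv]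
  have h := congrArg (eval₂Hom f ![a, b, c]) hpoly
  rw [map_uEval, map_uEval, Subsingleton.elim ((eval₂Hom f ![a, b, c]).comp C) f] at h
  convert h using 2 <;> funext i <;> fin_cases i <;> simp

lemma collUEval_zero {K : Type} [Field K] (f : ℚ →+* K) (M : Mould) (a b c d : K) :
    collUEval f M (t := 2) 0 ![a, b, c, d]
      = (uEval f M ![a, c, d] - uEval f M ![b, c, d]) / (a - b) := by
  unfold collUEval
  congr 3
  all_goals
    funext i
    fin_cases i <;> rfl

lemma collUEval_one {K : Type} [Field K] (f : ℚ →+* K) (M : Mould) (a b c d : K) :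
    collUEval f M (t := 2) 1 ![a, b, c, d]
      = (uEval f M ![a, b, d] - uEval f M ![a, c, d]) / (b - c) := by
  unfold collUEval
  congr 3 <;> funext i <;> fin_cases i <;> rfl

lemma collUEval_two {K : Type} [Field K] (f : ℚ →+* K) (M : Mould) (a b c d : K) :
    collUEval f M (t := 2) 2 ![a, b, c, d]
      = (uEval f M ![a, b, c] - uEval f M ![a, b, d]) / (c - d) := by
  unfold collUEval
  congr 3 <;> funext i <;> fin_cases i <;> rfl

/-- Let `M` be a mould with `M^0 = 0`, `M^1 = 0` such that
`ũ(M)^3(x_1,x_2,x_3) = ũ(M)^3(-x_2,-x_3,-x_1)` holds identically.  Then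
`coll^4_{3,4}(ũ(M))(x_1,x_3,x_2,x_4) = -coll^4_{2,3}(ũ(M))(-x_3,-x_2,-x_4,-x_1)` and
`coll^4_{1,2}(ũ(M))(x_1,x_2,x_3,x_4) = -coll^4_{3,4}(ũ(M))(-x_3,-x_4,-x_1,-x_2)`
in `ℚ(x_1,x_2,x_3,x_4)`. -/
theorem coll_identities (M : Mould) (h0 : M 0 = 0) (h1 : M 1 = 0)
    (hcyc : uEval (Rat.castHom (FF 3)) M ![xv 0, xv 1, xv 2]
        = uEval (Rat.castHom (FF 3)) M ![-xv 1, -xv 2, -xv 0]) :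
    collUEval (Rat.castHom (FF 4)) M 2 ![xv 0, xv 2, xv 1, xv 3]
        = -collUEval (Rat.castHom (FF 4)) M 1 ![-xv 2, -xv 1, -xv 3, -xv 0] ∧
    collUEval (Rat.castHom (FF 4)) M 0 ![xv 0, xv 1, xv 2, xv 3]
        = -collUEval (Rat.castHom (FF 4)) M 2 ![-xv 2, -xv 3, -xv 0, -xv 1] := by
  have hu := uEval_three_eq_of_generic (Rat.castHom (FF 4)) M hcyc
  constructor
  · rw [collUEval_two, collUEval_one, hu (xv 0) (xv 2) (xv 1), hu (xv 0) (xv 2) (xv 3),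
      ← div_neg]
    congr 1
    ring
  · rw [collUEval_zero, collUEval_two, hu (xv 0) (xv 2) (xv 3), hu (xv 1) (xv 2) (xv 3),
      ← div_neg]
    congr 1
    ring
end
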